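/- Let G be a finitely generated abelian group and let β_i : G → G (i ∈ ℕ) be any sequence of group homomorphisms. Then the torsion subgroup of the direct limit lim→(G, β_i) is finite, and its cardinality is at most the cardinality of the torsion subgroup T(G) of G. -/

import Mathlib

/-- The composition `β (i + j - 1) ∘ ⋯ ∘ β (i + 1) ∘ β i` (with `sysMap β i 0 = id`); thus
`sysMap β i (j - i)` is the transition map from index `i` to index `j` of the inductive system
`G →β₀ G →β₁ G →β₂ ⋯`. -/
def sysMap {G : Type*} [AddCommGroup G] (β : ℕ → G →+ G) (i : ℕ) : ℕ → (G →+ G)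
  | 0 => AddMonoidHom.id G
  | j + 1 => (β (i + j)).comp (sysMap β i j)

/-- The torsion subgroup of a finitely generated abelian group is finite. -/
theorem AddCommGroup.finite_torsion_of_fg (G : Type*) [AddCommGroup G] [AddGroup.FG G] :
    Finite (AddCommGroup.torsion G) := by
  have : Module.Finite ℤ G := Module.Finite.iff_addGroup_fg.mpr inferInstance
  have : Module.Finite ℤ (AddCommGroup.torsion G) :=
    inferInstanceAs (Module.Finite ℤ (AddSubgroup.toIntSubmodule (AddCommGroup.torsion G)))
  have : AddGroup.FG (AddCommGroup.torsion G) := Module.Finite.iff_addGroup_fg.mp this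
  exact AddCommGroup.finite_of_fg_isAddTorsion _ (AddCommMonoid.addTorsion.isAddTorsion (G := G))

theorem sysMap_sysMap {G : Type*} [AddCommGroup G] (β : ℕ → G →+ G) (i a b : ℕ) (x : G) :
    sysMap β (i + a) b (sysMap β i a x) = sysMap β i (a + b) x := by
  induction b with
  | zero => rfl
  | succ b ih =>
    change β (i + a + b) (sysMap β (i + a) b (sysMap β i a x)) =
      β (i + (a + b)) (sysMap β i (a + b) x)
    rw [ih, add_assoc]

instance sysMap_directedSystem {G : Type*} [AddCommGroup G] (β : ℕ → G →+ G) :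
    DirectedSystem (fun _ : ℕ => G) (fun i j (_ : i ≤ j) => sysMap β i (j - i)) where
  map_self i x := by simp [sysMap]
  map_map k j i hij hjk x := by
    obtain ⟨a, rfl⟩ := Nat.exists_eq_add_of_le hij
    obtain ⟨b, rfl⟩ := Nat.exists_eq_add_of_le hjk
    have h₁ : i + a + b - (i + a) = b := by lia
    have h₂ : i + a + b - i = a + b := by lia
    have h₃ : i + a - i = a := by lia
    rw [h₁, h₂, h₃, sysMap_sysMap]

/-- A torsion element of the direct limit is represented by a torsion element at every
sufficiently large index. -/
theorem eventually_exists_torsion_of_eq {G : Type*} [AddCommGroup G] (β : ℕ → G →+ G)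
    {z : AddCommGroup.DirectLimit (fun _ : ℕ => G) (fun i j _ => sysMap β i (j - i))}
    (hz : z ∈ AddCommGroup.torsion
      (AddCommGroup.DirectLimit (fun _ : ℕ => G) (fun i j _ => sysMap β i (j - i)))) :
    ∀ᶠ k in Filter.atTop, ∃ g ∈ AddCommGroup.torsion G,
      AddCommGroup.DirectLimit.of (fun _ : ℕ => G) (fun i j _ => sysMap β i (j - i)) k g = z := by
  induction z using AddCommGroup.DirectLimit.induction_on with
  | ih i x =>
    obtain ⟨n, hn, hnx⟩ := isOfFinAddOrder_iff_nsmul_eq_zero.mp hz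
    rw [← map_nsmul] at hnx
    obtain ⟨j, hij, hj⟩ := AddCommGroup.DirectLimit.of.zero_exact i _ hnx
    filter_upwards [Filter.eventually_ge_atTop j] with k hjk
    refine ⟨sysMap β i (k - i) x, ?_, AddCommGroup.DirectLimit.of_f
      (f := fun i j _ => sysMap β i (j - i)) (hij.trans hjk) x⟩
    refine isOfFinAddOrder_iff_nsmul_eq_zero.mpr ⟨n, hn, ?_⟩
    rw [← map_nsmul, ← (sysMap_directedSystem β).map_map hij hjk, hj, map_zero]

theorem card_le_card_torsion_of_subset_torsion {G : Type*} [AddCommGroup G] [AddGroup.FG G]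
    (β : ℕ → G →+ G)
    (s : Finset (AddCommGroup.DirectLimit (fun _ : ℕ => G) (fun i j _ => sysMap β i (j - i))))
    (hs : ∀ z ∈ s, z ∈ AddCommGroup.torsion
      (AddCommGroup.DirectLimit (fun _ : ℕ => G) (fun i j _ => sysMap β i (j - i)))) :
    s.card ≤ Nat.card (AddCommGroup.torsion G) := by
  have := AddCommGroup.finite_torsion_of_fg G
  obtain ⟨k, hk⟩ := ((Filter.eventually_all_finset s).mpr fun z hz =>
    eventually_exists_torsion_of_eq β (hs z hz)).exists
  choose g hg hgz using hk
  rw [← Nat.card_eq_finsetCard]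
  refine Nat.card_le_card_of_injective
    (fun z : s => (⟨g z.1 z.2, hg z.1 z.2⟩ : AddCommGroup.torsion G)) fun y z hyz => ?_
  apply Subtype.ext
  rw [← hgz y.1 y.2, ← hgz z.1 z.2, show g y.1 y.2 = g z.1 z.2 from congrArg Subtype.val hyz]

/-- Let `G` be a finitely generated abelian group and `βᵢ : G → G` (`i ∈ ℕ`)
any sequence of group homomorphisms.  Then the torsion subgroup of the direct limit
`lim→(G, βᵢ)` is finite, and its cardinality is at most the cardinality of the torsion
subgroup `T(G)` of `G`. -/
theorem stmt3 {G : Type*} [AddCommGroup G] [AddGroup.FG G] (β : ℕ → G →+ G) :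
    (AddCommGroup.torsion
        (AddCommGroup.DirectLimit (fun _ : ℕ => G) (fun i j _ => sysMap β i (j - i))) :
      Set (AddCommGroup.DirectLimit (fun _ : ℕ => G)
        (fun i j _ => sysMap β i (j - i)))).Finite ∧
    Nat.card (AddCommGroup.torsion
        (AddCommGroup.DirectLimit (fun _ : ℕ => G) (fun i j _ => sysMap β i (j - i)))) ≤
      Nat.card (AddCommGroup.torsion G) := by
  have bound := card_le_card_torsion_of_subset_torsion β
  refine and_iff_left_of_imp (fun hfin => ?_) |>.mpr ?_
  · have h := bound hfin.toFinset fun x hx => hfin.mem_toFinset.mp hx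
    rwa [← Set.ncard_eq_toFinset_card _ hfin] at h
  · by_contra hinf
    obtain ⟨s, hs, hcard⟩ :=
      Set.Infinite.exists_subset_card_eq hinf (Nat.card (AddCommGroup.torsion G) + 1)
    have := bound s fun x hx => hs hx
    lia
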